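/- Let C ≥ 2 be a natural number, J > 0 a real number, and y_i ≠ y_j two distinct classes in Fin C. Let a and b be probability vectors on Fin C such that: a_{y_i} ≥ 1/2 + 1/J; a_c ≤ (1 − a_{y_i})/(C − 1) for every c ≠ y_i; 1/2 ≤ b_{y_j} ≤ 1/2 + 1/J; and b_c ≤ (1 − b_{y_j})/(C − 1) for every c with c ≠ y_i and c ≠ y_j. Then for every c ≠ y_i, a_c + b_c ≤ a_{y_i} + b_{y_i}; i.e., the class y_i attains the maximum of the averaged vector c ↦ (a_c + b_c)/2. -/

import Mathlib

open Finset

/-- Case III of the ensemble analysis in Theorem 5.1 for the average combiner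
(Eqs. (50)–(57)): if `a` confidently places class `y_i` with small scores on the other
classes, and `b` mildly places class `y_j` with small scores on the classes other than
`y_i` and `y_j`, then class `y_i` attains the maximum of the averaged vector
`c ↦ (a_c + b_c)/2`. -/
theorem average_combiner_classifies_correctly
    (C : ℕ) (hC : 2 ≤ C) (J : ℝ) (hJ : 0 < J)
    (yi yj : Fin C) (hy : yi ≠ yj)
    (a b : Fin C → ℝ)
    (hapos : ∀ c, 0 ≤ a c) (hasum : ∑ c, a c = 1)
    (hbpos : ∀ c, 0 ≤ b c) (hbsum : ∑ c, b c = 1)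
    (ha1 : a yi ≥ 1 / 2 + 1 / J)
    (ha2 : ∀ c, c ≠ yi → a c ≤ (1 - a yi) / ((C : ℝ) - 1))
    (hb1 : 1 / 2 ≤ b yj) (hb2 : b yj ≤ 1 / 2 + 1 / J)
    (hb3 : ∀ c, c ≠ yi → c ≠ yj → b c ≤ (1 - b yj) / ((C : ℝ) - 1)) :
    ∀ c, c ≠ yi → a c + b c ≤ a yi + b yi := by
  have hn : (1 : ℝ) ≤ (C : ℝ) - 1 := by
    have : (2 : ℝ) ≤ (C : ℝ) := by exact_mod_cast hC
    linarith
  have hn0 : (0 : ℝ) < (C : ℝ) - 1 := by linarith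
  have hJ' : 0 < 1 / J := by positivity
  have hk : ((C : ℝ) - 1) * ((1 - b yj) / ((C : ℝ) - 1)) = 1 - b yj := by
    field_simp
  have hcard : ((((univ : Finset (Fin C)).erase yi).erase yj).card : ℝ) = (C : ℝ) - 2 := by
    rw [card_erase_of_mem (by simp [hy.symm]), card_erase_of_mem (mem_univ _), card_univ,
      Fintype.card_fin, Nat.sub_sub, Nat.cast_sub (by omega)]
    norm_num
  have h1 := add_sum_erase univ b (mem_univ yi)
  have h2 := add_sum_erase (univ.erase yi) b (a := yj) (by simp [hy.symm])
  have h3 : ∑ c ∈ (univ.erase yi).erase yj, b c ≤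
      ((C : ℝ) - 2) * ((1 - b yj) / ((C : ℝ) - 1)) := by
    have := sum_le_card_nsmul ((univ.erase yi).erase yj) b ((1 - b yj) / ((C : ℝ) - 1))
      (fun c hc => by
        simp only [mem_erase, mem_univ, and_true] at hc
        exact hb3 c hc.2 hc.1)
    rwa [nsmul_eq_mul, hcard] at this
  have hbi : (1 - b yj) / ((C : ℝ) - 1) ≤ b yi := by linarith
  have ha : a yi ≤ 1 := by
    rw [← hasum]
    exact single_le_sum (fun c _ => hapos c) (mem_univ yi)
  intro c hc
  have hac := ha2 c hc
  by_cases h : c = yj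
  · subst h
    have : (1 - a yi) / ((C : ℝ) - 1) ≤ (1 - b c) / ((C : ℝ) - 1) := by
      gcongr
      linarith
    linarith
  · have := hb3 c hc h
    have : (1 - a yi) / ((C : ℝ) - 1) ≤ 1 - a yi := div_le_self (by linarith) hn
    linarith
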